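/- Let R be a Noetherian local ring of characteristic p > 0 that is regular. Then every ideal of R is tightly closed; in particular R is F-rational. -/

import Mathlib

/-- `R°`: the set of elements of `R` not contained in any minimal prime ideal. -/
def Rcirc (R : Type) [CommRing R] : Set R := {c | ∀ P ∈ minimalPrimes R, c ∉ P}

/-- The `q`-th Frobenius power `I^{[q]}` of an ideal: the ideal generated by
`q`-th powers of elements of `I`. -/
def frobeniusPower {R : Type} [CommRing R] (I : Ideal R) (q : ℕ) : Ideal R :=
  Ideal.span ((fun x => x ^ q) '' (I : Set R))

/-- The tight closure `I*` of an ideal `I`, as a set: those `x` such that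
`c x^{p^e} ∈ I^{[p^e]}` for some `c ∈ R°` and all `e ≫ 0`. -/
def tightClosureSet {R : Type} [CommRing R] (p : ℕ) (I : Ideal R) : Set R :=
  {x | ∃ c ∈ Rcirc R, ∃ e₀ : ℕ, ∀ e ≥ e₀, c * x ^ p ^ e ∈ frobeniusPower I (p ^ e)}

open RingTheory.Sequence IsLocalRing Pointwise

/-- Some prime realizes the Krull dimension. -/
lemma exists_prime_dim {R : Type*} [CommRing R] [Nontrivial R] (d : ℕ) (hd : (d : WithBot ℕ∞) ≤ ringKrullDim R) :
    ∃ Q : Ideal R, Q.IsPrime ∧ (d : WithBot ℕ∞) ≤ ringKrullDim (R ⧸ Q) := by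
  obtain ⟨l, hl⟩ := Order.le_krullDim_iff.mp hd
  refine ⟨l.head.asIdeal, l.head.2, ?_⟩
  rw [ringKrullDim_quotient]
  refine Order.le_krullDim_iff.mpr ⟨⟨l.length, fun i => ⟨l i, ?_⟩, fun i => l.step i⟩, hl⟩
  exact l.head_le i

lemma dim_le_quot_succ {R : Type*} [CommRing R] [IsNoetherianRing R] [IsLocalRing R] {x : R}
    (hx : x ∈ maximalIdeal R) : ringKrullDim R ≤ ringKrullDim (R ⧸ Ideal.span {x}) + 1 := by
  have := ringKrullDim_le_ringKrullDim_quotient_add_encard {x}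
    (by simpa [IsLocalRing.ringJacobson_eq_maximalIdeal] using hx)
  rw [Set.encard_singleton] at this
  exact this

lemma enat_cancel {d : ℕ} {a : WithBot ℕ∞} (h : (d : WithBot ℕ∞) + 1 ≤ a + 1) : 
    (d : WithBot ℕ∞) ≤ a := by
  induction a with
  | bot => simp at h
  | coe a =>
    induction a with
    | top => exact le_top
    | coe a => norm_cast at h ⊢; exact_mod_cast (by simpa using h)

theorem regular_seq (d : ℕ) : ∀ (R : Type) [CommRing R] [IsNoetherianRing R] [IsLocalRing R]
    (_ : ringKrullDim R = d) (xs : List R) (_ : xs.length = d)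
    (_ : Ideal.ofList xs = maximalIdeal R), IsDomain R ∧ IsWeaklyRegular R xs := by
  induction d with
  | zero =>
    intro R _ _ _ hd xs hl hm
    obtain rfl := List.length_eq_zero_iff.mp hl
    refine ⟨?_, IsWeaklyRegular.nil _ _⟩
    rw [Ideal.ofList_nil] at hm
    have : IsField R := IsLocalRing.isField_iff_maximalIdeal_eq.mpr hm.symm
    exact this.isDomain
  | succ d ih =>
    intro R _ _ _ hd xs hl hm
    obtain ⟨x, ys, rfl⟩ : ∃ x ys, xs = x :: ys := by
      cases xs with
      | nil => simp at hl
      | cons x ys => exact ⟨x, ys, rfl⟩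
    have hl' : ys.length = d := by simpa using hl
    have hxm : x ∈ maximalIdeal R := by
      rw [← hm]; exact Ideal.subset_span (by simp)
    have hne : Ideal.span {x} ≠ ⊤ := by
      rw [Ne, Ideal.span_singleton_eq_top]; exact hxm
    let R' := R ⧸ Ideal.span {x}
    have : Nontrivial R' := Ideal.Quotient.nontrivial_iff.mpr hne
    have hsurj : Function.Surjective (Ideal.Quotient.mk (Ideal.span {x})) :=
      Ideal.Quotient.mk_surjective
    have : IsLocalRing R' := IsLocalRing.of_surjective' _ hsurj
    have hm' : Ideal.ofList (ys.map (Ideal.Quotient.mk (Ideal.span {x}))) = maximalIdeal R' := by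
      rw [← Ideal.map_ofList, ← IsLocalRing.map_maximalIdeal_of_surjective _ hsurj, ← hm,
        Ideal.ofList_cons, Ideal.map_sup, Ideal.map_quotient_self, bot_sup_eq]
    have hdle : ringKrullDim R' ≤ d := by
      refine (ringKrullDim_le_spanFinrank_maximalIdeal R').trans ?_
      rw [← hm']
      have h1 := Submodule.spanFinrank_span_le_ncard_of_finite (R := R') 
        (List.finite_toSet (ys.map (Ideal.Quotient.mk (Ideal.span {x}))))
      have h2 : ({r | r ∈ ys.map (Ideal.Quotient.mk (Ideal.span {x}))} : Set R').ncard ≤ d := by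
        classical
        have := List.toFinset_card_le (ys.map (Ideal.Quotient.mk (Ideal.span {x})))
        rw [← List.coe_toFinset, Set.ncard_coe_finset]
        simpa [hl'] using this
      exact_mod_cast h1.trans h2
    have hdge : (d : WithBot ℕ∞) ≤ ringKrullDim R' := by
      have := dim_le_quot_succ hxm
      rw [hd] at this
      push_cast at this
      exact enat_cancel this
    have hd' := le_antisymm hdle hdge
    obtain ⟨hdom, hreg⟩ := ih R' hd' _ (by simpa using hl') hm'
    obtain ⟨Q, hQ, hQd⟩ := exists_prime_dim (R := R) (d+1) (by rw [hd])
    have hlt : ¬ ((d : WithBot ℕ∞) + 1 ≤ d) := by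
      norm_cast; omega
    push_cast at hQd
    have hxQ : x ∉ Q := by
      intro h
      apply hlt
      rw [← hd'] at hQd ⊢
      refine hQd.trans (ringKrullDim_le_of_surjective (Ideal.Quotient.factor (S := Ideal.span {x}) (T := Q) ?_)
        (Ideal.Quotient.factor_surjective _))
      simpa [Ideal.span_le] using h
    have hQx : Q ≤ Ideal.span {x} := by
      intro q hq
      by_contra hqx
      apply hlt
      have hq0 : Ideal.Quotient.mk (Ideal.span {x}) q ≠ 0 := by
        rwa [Ne, Ideal.Quotient.eq_zero_iff_mem]
      let S := (R ⧸ Q) ⧸ Ideal.span {Ideal.Quotient.mk Q x}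
      let f : R →+* S := (Ideal.Quotient.mk _).comp (Ideal.Quotient.mk Q)
      let g : R' →+* S := Ideal.Quotient.lift (Ideal.span {x}) f (by
        intro a ha
        obtain ⟨b, rfl⟩ := Ideal.mem_span_singleton'.mp ha
        refine Ideal.Quotient.eq_zero_iff_mem.mpr ?_
        rw [map_mul]
        exact Ideal.mul_mem_left _ _ (Ideal.mem_span_singleton_self _))
      have h1 := ringKrullDim_succ_le_of_surjective g
        (Ideal.Quotient.lift_surjective_of_surjective _ _
          (Ideal.Quotient.mk_surjective.comp Ideal.Quotient.mk_surjective))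
        (mem_nonZeroDivisors_of_ne_zero hq0) (by
          change f q = 0
          change Ideal.Quotient.mk _ (Ideal.Quotient.mk Q q) = 0
          rw [Ideal.Quotient.eq_zero_iff_mem.mpr hq, map_zero])
      have : Nontrivial (R ⧸ Q) := Ideal.Quotient.nontrivial_iff.mpr hQ.ne_top
      have : IsLocalRing (R ⧸ Q) := IsLocalRing.of_surjective' _ Ideal.Quotient.mk_surjective
      have h2 := dim_le_quot_succ (R := R ⧸ Q) (x := Ideal.Quotient.mk Q x)
        (by
          rw [← IsLocalRing.map_maximalIdeal_of_surjective _ (Ideal.Quotient.mk_surjective (I := Q))]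
          exact Ideal.mem_map_of_mem _ hxm)
      rw [← hd'] at hQd ⊢
      exact (hQd.trans h2).trans h1
    have hQ0 : Q = ⊥ := by
      apply Submodule.eq_bot_of_le_smul_of_le_jacobson_bot (maximalIdeal R) Q
        (IsNoetherian.noetherian _) _ (IsLocalRing.maximalIdeal_le_jacobson _)
      intro q hq
      obtain ⟨b, rfl⟩ := Ideal.mem_span_singleton'.mp (hQx hq)
      rw [mul_comm]
      exact Submodule.smul_mem_smul hxm ((hQ.mem_or_mem hq).resolve_right hxQ)
    subst hQ0
    have hdomR : IsDomain R := by
      exact IsDomain.of_bot_isPrime R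
    refine ⟨hdomR, ?_⟩
    rw [isWeaklyRegular_cons_iff]
    have hx0 : x ≠ 0 := fun h => hxQ (by simp [h])
    refine ⟨fun a b h => mul_left_cancel₀ hx0 h, ?_⟩
    have heq : (Ideal.span {x} : Ideal R) = x • (⊤ : Ideal R) := by
      simp [← Submodule.ideal_span_singleton_smul]
    have e : R' ≃ₗ[R] QuotSMulTop x R := Submodule.quotEquivOfEq _ _ heq
    have := (isWeaklyRegular_map_algebraMap_iff R' R' ys).mp hreg
    exact (e.isWeaklyRegular_congr ys).mp this


lemma wreg_ses {R : Type*} [CommRing R] (rs : List R) : ∀ {N M Q : Type*}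
    [AddCommGroup N] [AddCommGroup M] [AddCommGroup Q] [Module R N] [Module R M] [Module R Q]
    (f : N →ₗ[R] M) (g : M →ₗ[R] Q) (_ : Function.Injective f) (_ : Function.Surjective g)
    (_ : Function.Exact f g) (_ : IsWeaklyRegular N rs) (_ : IsWeaklyRegular Q rs),
    IsWeaklyRegular M rs ∧ Module.length R (M ⧸ (Ideal.ofList rs • ⊤ : Submodule R M)) =
      Module.length R (N ⧸ (Ideal.ofList rs • ⊤ : Submodule R N)) +
      Module.length R (Q ⧸ (Ideal.ofList rs • ⊤ : Submodule R Q)) := by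
  induction rs with
  | nil =>
    intro N M Q _ _ _ _ _ _ f g hf hg hfg _ _
    refine ⟨IsWeaklyRegular.nil _ _, ?_⟩
    rw [(Submodule.quotEquivOfEqBot (Ideal.ofList ([] : List R) • ⊤ : Submodule R N) (by simp)).length_eq,
      (Submodule.quotEquivOfEqBot (Ideal.ofList ([] : List R) • ⊤ : Submodule R M) (by simp)).length_eq,
      (Submodule.quotEquivOfEqBot (Ideal.ofList ([] : List R) • ⊤ : Submodule R Q) (by simp)).length_eq]
    exact Module.length_eq_add_of_exact f g hf hg hfg
  | cons r rs ih =>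
    intro N M Q _ _ _ _ _ _ f g hf hg hfg hN hQ
    rw [isWeaklyRegular_cons_iff] at hN hQ ⊢
    have hinj : Function.Injective (QuotSMulTop.map r f) := by
      have h0 : Function.Exact (0 : N →ₗ[R] N) f := by
        rw [LinearMap.exact_zero_iff_injective]; exact hf
      have := QuotSMulTop.map_first_exact_on_four_term_exact_of_isSMulRegular_last h0 hfg hQ.1
      rw [map_zero] at this
      exact (LinearMap.exact_zero_iff_injective _ _).mp this
    have key := ih (QuotSMulTop.map r f) (QuotSMulTop.map r g) hinj
      (QuotSMulTop.map_surjective r hg) (QuotSMulTop.map_exact r hfg hg) hN.2 hQ.2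
    refine ⟨⟨isSMulRegular_of_range_eq_ker hf hfg.linearMap_ker_eq.symm hN.1 hQ.1, key.1⟩, ?_⟩
    rw [(Submodule.quotOfListConsSMulTopEquivQuotSMulTopInner N r rs).length_eq,
      (Submodule.quotOfListConsSMulTopEquivQuotSMulTopInner M r rs).length_eq,
      (Submodule.quotOfListConsSMulTopEquivQuotSMulTopInner Q r rs).length_eq]
    exact key.2

lemma wreg_pow_head {R : Type*} [CommRing R] {M : Type*} [AddCommGroup M] [Module R M]
    (r : R) (rs : List R) (hr : IsSMulRegular M r) (h : IsWeaklyRegular (QuotSMulTop r M) rs) (a : ℕ) :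
    IsWeaklyRegular (QuotSMulTop (r ^ (a + 1)) M) rs ∧
    Module.length R (QuotSMulTop (r ^ (a + 1)) M ⧸ (Ideal.ofList rs • ⊤ : Submodule R (QuotSMulTop (r ^ (a + 1)) M)))
      = ((a + 1 : ℕ) : ℕ∞) *
      Module.length R (QuotSMulTop r M ⧸ (Ideal.ofList rs • ⊤ : Submodule R (QuotSMulTop r M))) := by
  induction a with
  | zero => 
    rw [zero_add, pow_one]
    exact ⟨h, by simp⟩
  | succ a ih =>
    let f : QuotSMulTop r M →ₗ[R] QuotSMulTop (r ^ (a + 1 + 1)) M :=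
      Submodule.mapQ _ _ (LinearMap.lsmul R M (r ^ (a + 1))) (by
        intro x hx
        obtain ⟨y, -, rfl⟩ := (Submodule.mem_smul_pointwise_iff_exists _ _ _).mp hx
        refine (Submodule.mem_smul_pointwise_iff_exists _ _ _).mpr ⟨y, trivial, ?_⟩
        simp only [LinearMap.lsmul_apply, smul_smul]
        congr 1; ring)
    let g : QuotSMulTop (r ^ (a + 1 + 1)) M →ₗ[R] QuotSMulTop (r ^ (a + 1)) M :=
      Submodule.mapQ _ _ LinearMap.id (by
        intro x hx
        obtain ⟨y, -, rfl⟩ := (Submodule.mem_smul_pointwise_iff_exists _ _ _).mp hx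
        refine (Submodule.mem_smul_pointwise_iff_exists _ _ _).mpr ⟨r • y, trivial, ?_⟩
        simp [smul_smul, pow_succ])
    have hf : Function.Injective f := by
      rw [injective_iff_map_eq_zero]
      intro x hx
      obtain ⟨x, rfl⟩ := Submodule.Quotient.mk_surjective _ x
      erw [Submodule.mapQ_apply, Submodule.Quotient.mk_eq_zero] at hx
      obtain ⟨y, -, hy⟩ := (Submodule.mem_smul_pointwise_iff_exists _ _ _).mp hx
      rw [pow_succ, mul_smul] at hy
      have := (hr.pow (a+1)) hy
      rw [Submodule.Quotient.mk_eq_zero]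
      exact (Submodule.mem_smul_pointwise_iff_exists _ _ _).mpr ⟨y, trivial, this⟩
    have hg : Function.Surjective g := by
      intro x
      obtain ⟨x, rfl⟩ := Submodule.Quotient.mk_surjective _ x
      exact ⟨Submodule.Quotient.mk x, rfl⟩
    have hfg : Function.Exact f g := by
      intro x
      obtain ⟨x, rfl⟩ := Submodule.Quotient.mk_surjective _ x
      constructor
      · intro hx
        erw [Submodule.mapQ_apply, Submodule.Quotient.mk_eq_zero] at hx
        obtain ⟨y, -, hy⟩ := (Submodule.mem_smul_pointwise_iff_exists _ _ _).mp hx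
        refine ⟨Submodule.Quotient.mk y, ?_⟩
        erw [Submodule.mapQ_apply]
        congr 1
      · rintro ⟨y, hy⟩
        obtain ⟨y, rfl⟩ := Submodule.Quotient.mk_surjective _ y
        rw [← hy]
        erw [Submodule.mapQ_apply]
        refine (Submodule.Quotient.mk_eq_zero _).mpr ?_
        exact (Submodule.mem_smul_pointwise_iff_exists _ _ _).mpr ⟨y, trivial, rfl⟩
    have := wreg_ses rs f g hf hg hfg h ih.1
    refine ⟨this.1, ?_⟩
    rw [this.2, ih.2]
    push_cast
    ring

lemma length_pow {R : Type*} [CommRing R] (n : ℕ) (rs : List R) : ∀ {M : Type*} [AddCommGroup M] [Module R M]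
    (_ : IsWeaklyRegular M rs),
    Module.length R (M ⧸ (Ideal.ofList (rs.map (· ^ (n + 1))) • ⊤ : Submodule R M)) =
     (((n + 1) ^ rs.length : ℕ) : ℕ∞) * Module.length R (M ⧸ (Ideal.ofList rs • ⊤ : Submodule R M)) := by
  induction rs with
  | nil => intro M _ _ _; rw [List.map_nil]; simp
  | cons r rs ih =>
    intro M _ _ h
    rw [isWeaklyRegular_cons_iff] at h
    have := wreg_pow_head r rs h.1 h.2 n
    rw [List.map_cons, (Submodule.quotOfListConsSMulTopEquivQuotSMulTopInner M _ _).length_eq,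
      (Submodule.quotOfListConsSMulTopEquivQuotSMulTopInner M _ _).length_eq, ih this.1, this.2,
      List.length_cons, pow_succ]
    push_cast
    ring


/-- The colon ideal `I : x`. -/
def colonElt {R : Type*} [CommRing R] (I : Ideal R) (x : R) : Ideal R :=
  Submodule.comap (LinearMap.toSpanSingleton R R x) I

lemma mem_colonElt {R : Type*} [CommRing R] {I : Ideal R} {x a : R} :
    a ∈ colonElt I x ↔ a * x ∈ I := Iff.rfl

lemma length_colonElt {R : Type*} [CommRing R] (I : Ideal R) (x : R) :
    Module.length R (R ⧸ I) = Module.length R (R ⧸ colonElt I x) +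
      Module.length R (R ⧸ (I ⊔ Ideal.span {x})) := by
  let f : (R ⧸ colonElt I x) →ₗ[R] (R ⧸ I) :=
    Submodule.mapQ (colonElt I x) I (LinearMap.toSpanSingleton R R x) le_rfl
  let g : (R ⧸ I) →ₗ[R] (R ⧸ (I ⊔ Ideal.span {x})) :=
    Submodule.mapQ I (I ⊔ Ideal.span {x}) LinearMap.id (fun a ha => Ideal.mem_sup_left ha)
  refine Module.length_eq_add_of_exact f g ?_ ?_ ?_
  · rw [injective_iff_map_eq_zero]
    intro a ha
    obtain ⟨a, rfl⟩ := Submodule.Quotient.mk_surjective _ a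
    exact (Submodule.Quotient.mk_eq_zero _).mpr ((Submodule.Quotient.mk_eq_zero I).mp ha)
  · intro a
    obtain ⟨a, rfl⟩ := Submodule.Quotient.mk_surjective _ a
    exact ⟨Submodule.Quotient.mk a, rfl⟩
  · intro a
    obtain ⟨a, rfl⟩ := Submodule.Quotient.mk_surjective _ a
    constructor
    · intro ha
      have ha' : a ∈ I ⊔ Ideal.span {x} := (Submodule.Quotient.mk_eq_zero _).mp ha
      obtain ⟨b, hb, c, hc, rfl⟩ := Submodule.mem_sup.mp ha'
      obtain ⟨e, rfl⟩ := Ideal.mem_span_singleton'.mp hc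
      refine ⟨Submodule.Quotient.mk e, ?_⟩
      refine (Submodule.Quotient.eq I).mpr ?_
      have : LinearMap.toSpanSingleton R R x e - (b + e * x) = - b := by
        simp
      rw [this]
      exact I.neg_mem hb
    · rintro ⟨e, he⟩
      obtain ⟨e, rfl⟩ := Submodule.Quotient.mk_surjective _ e
      rw [← he]
      refine (Submodule.Quotient.mk_eq_zero (I ⊔ Ideal.span {x})).mpr ?_
      exact Ideal.mem_sup_right (Ideal.mul_mem_left _ _ (Ideal.mem_span_singleton_self x))

lemma length_anti {R : Type*} [CommRing R] {I K : Ideal R} (h : I ≤ K) :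
    Module.length R (R ⧸ K) ≤ Module.length R (R ⧸ I) :=
  Module.length_le_of_surjective (Submodule.factor h) (Submodule.factor_surjective h)

lemma exists_socle {R : Type*} [CommRing R] [IsLocalRing R] {I K : Ideal R} (hK : ¬ K ≤ I)
    {n : ℕ} (hn : maximalIdeal R ^ n ≤ I) :
    ∃ z ∈ K, z ∉ I ∧ colonElt I z = maximalIdeal R := by
  classical
  have hex : ∃ k, maximalIdeal R ^ k * K ≤ I := ⟨n, Ideal.mul_le_left.trans hn⟩
  have hs := Nat.find_spec hex
  obtain ⟨k, hk⟩ : ∃ k, Nat.find hex = k + 1 := by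
    refine Nat.exists_eq_succ_of_ne_zero fun h => hK ?_
    rw [h] at hs
    simpa using hs
  have hm := Nat.find_min hex (m := k) (by omega)
  rw [hk] at hs
  obtain ⟨z, hz, hzI⟩ := SetLike.not_le_iff_exists.mp hm
  refine ⟨z, Ideal.mul_le_right hz, hzI, ?_⟩
  apply le_antisymm
  · apply IsLocalRing.le_maximalIdeal
    rw [Ne, Ideal.eq_top_iff_one, mem_colonElt, one_mul]
    exact hzI
  · intro a ha
    rw [mem_colonElt]
    apply hs
    rw [pow_succ', mul_assoc]
    exact Ideal.mul_mem_mul ha hz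

lemma map_le_colonElt {R : Type*} [CommRing R] (φ : R →+* R) (I : Ideal R) (z : R) :
    (colonElt I z).map φ ≤ colonElt (I.map φ) (φ z) := by
  rw [Ideal.map_le_iff_le_comap]
  intro a ha
  rw [Ideal.mem_comap, mem_colonElt, ← map_mul]
  exact Ideal.mem_map_of_mem _ ha

lemma map_sup_span {R : Type*} [CommRing R] (φ : R →+* R) (I : Ideal R) (z : R) :
    (I ⊔ Ideal.span {z}).map φ = I.map φ ⊔ Ideal.span {φ z} := by
  rw [Ideal.map_sup, Ideal.map_span, Set.image_singleton]

lemma length_max {R : Type*} [CommRing R] [IsLocalRing R] :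
    Module.length R (R ⧸ maximalIdeal R) = 1 := by
  rw [Module.length_eq_one_iff, isSimpleModule_iff_isCoatom]
  exact (maximalIdeal.isMaximal R).out

lemma compare {R : Type*} [CommRing R] [IsNoetherianRing R] [IsLocalRing R] (φ : R →+* R)
    (n : ℕ) (I : Ideal R) (J : Ideal R) :
    maximalIdeal R ^ n ≤ J → J ≤ I →
    Module.length R (R ⧸ J.map φ) + Module.length R (R ⧸ (maximalIdeal R).map φ) * Module.length R (R ⧸ I)
    ≤ Module.length R (R ⧸ I.map φ) + Module.length R (R ⧸ (maximalIdeal R).map φ) * Module.length R (R ⧸ J) := by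
  induction J using IsNoetherian.induction with
  | hgt J ih =>
    intro hn hJI
    by_cases hIJ : I ≤ J
    · rw [le_antisymm hIJ hJI]
    obtain ⟨z, hzI, hzJ, hz⟩ := exists_socle hIJ hn
    have h1 := ih (J ⊔ Ideal.span {z}) (by
      refine lt_of_le_of_ne le_sup_left fun h => hzJ ?_
      rw [h]; exact Ideal.mem_sup_right (Ideal.mem_span_singleton_self z))
      (hn.trans le_sup_left) (sup_le hJI (by simpa [Ideal.span_le] using hzI))
    have h2 := length_colonElt J z
    rw [hz, length_max] at h2
    have h3 := length_colonElt (Ideal.map φ J) (φ z)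
    have h4 := length_anti (map_le_colonElt φ J z)
    rw [hz] at h4
    rw [map_sup_span] at h1
    rw [h2, h3, mul_add, mul_one]
    set L := Module.length R (R ⧸ (maximalIdeal R).map φ)
    calc _ ≤ (L + Module.length R (R ⧸ (Ideal.map φ J ⊔ Ideal.span {φ z}))) + L * Module.length R (R ⧸ I) := by gcongr
      _ = L + (Module.length R (R ⧸ (Ideal.map φ J ⊔ Ideal.span {φ z})) + L * Module.length R (R ⧸ I)) := by ring
      _ ≤ _ := by
        refine (add_le_add_right h1 L).trans (le_of_eq ?_)
        ring

lemma colon_key {R : Type*} [CommRing R] [IsNoetherianRing R] [IsLocalRing R] (φ : R →+* R)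
    (n : ℕ) (J I : Ideal R) (hn : maximalIdeal R ^ n ≤ J) (hJI : J ≤ I)
    (hf : Module.length R (R ⧸ J.map φ) ≠ ⊤) (hJ : Module.length R (R ⧸ J) ≠ ⊤)
    (hL : Module.length R (R ⧸ (maximalIdeal R).map φ) ≠ ⊤)
    (heq : Module.length R (R ⧸ J.map φ) =
      Module.length R (R ⧸ (maximalIdeal R).map φ) * Module.length R (R ⧸ J))
    (z : R) (hz : colonElt I z = maximalIdeal R) (c : R) (hc : c * φ z ∈ I.map φ) :
    c ∈ (maximalIdeal R).map φ := by
  have h1 := compare φ n I J hn hJI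
  have h2 := compare φ n ⊤ (I ⊔ Ideal.span {z}) ((hn.trans hJI).trans le_sup_left) le_top
  have h3 := length_colonElt I z
  have h4 := length_colonElt (I.map φ) (φ z)
  rw [hz, length_max] at h3
  rw [map_sup_span, Ideal.map_top] at h2
  have ht : Module.length R (R ⧸ (⊤ : Ideal R)) = 0 := by
    rw [Module.length_eq_zero_iff]; exact Submodule.Quotient.subsingleton_iff.mpr rfl
  rw [ht] at h2
  have h5 := length_colonElt ((maximalIdeal R).map φ) c
  have h6 : (maximalIdeal R).map φ ⊔ Ideal.span {c} ≤ colonElt (I.map φ) (φ z) := by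
    refine sup_le ?_ ?_
    · rw [← hz]; exact map_le_colonElt φ I z
    · rw [Ideal.span_le, Set.singleton_subset_iff]; exact hc
  have h6 := length_anti h6
  have h7 := length_anti (Ideal.map_mono (f := φ) hJI)
  have h8 := length_anti hJI
  have h0 : Module.length R (R ⧸ colonElt ((maximalIdeal R).map φ) c) = 0 := by
    generalize Module.length R (R ⧸ (maximalIdeal R).map φ) = L at *
    generalize Module.length R (R ⧸ colonElt ((maximalIdeal R).map φ) c) = u at *
    generalize Module.length R (R ⧸ ((maximalIdeal R).map φ ⊔ Ideal.span {c})) = v at *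
    generalize Module.length R (R ⧸ colonElt (I.map φ) (φ z)) = w at *
    generalize Module.length R (R ⧸ (I.map φ ⊔ Ideal.span {φ z})) = fK at *
    generalize Module.length R (R ⧸ I.map φ) = fI at *
    generalize Module.length R (R ⧸ J.map φ) = fJ at *
    generalize Module.length R (R ⧸ J) = HJ at *
    generalize Module.length R (R ⧸ I) = HI at *
    generalize Module.length R (R ⧸ (I ⊔ Ideal.span {z})) = HK at *
    have hfI := ne_top_of_le_ne_top hf h7
    have hHI := ne_top_of_le_ne_top hJ h8
    have hfK : fK ≠ ⊤ := ne_top_of_le_ne_top hfI (h4 ▸ le_add_self)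
    have hw : w ≠ ⊤ := ne_top_of_le_ne_top hfI (h4 ▸ le_self_add)
    have hHK : HK ≠ ⊤ := ne_top_of_le_ne_top hHI (h3 ▸ le_add_self)
    have hu : u ≠ ⊤ := ne_top_of_le_ne_top hL (h5 ▸ le_self_add)
    have hv : v ≠ ⊤ := ne_top_of_le_ne_top hL (h5 ▸ le_add_self)
    lift L to ℕ using hL
    lift fJ to ℕ using hf
    lift HJ to ℕ using hJ
    lift HI to ℕ using hHI
    lift fI to ℕ using hfI
    lift fK to ℕ using hfK
    lift w to ℕ using hw
    lift HK to ℕ using hHK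
    lift u to ℕ using hu
    lift v to ℕ using hv
    norm_cast at *
    simp at h2
    subst h3
    rw [mul_add] at h1
    omega
  rw [Module.length_eq_zero_iff, Submodule.Quotient.subsingleton_iff,
    Ideal.eq_top_iff_one, mem_colonElt, one_mul] at h0
  exact h0


lemma frobeniusPower_eq {R : Type} [CommRing R] (p : ℕ) [Fact p.Prime] [CharP R p] (I : Ideal R)
    (e : ℕ) : frobeniusPower I (p ^ e) = I.map (iterateFrobenius R p e) := rfl

lemma length_ofList_pow {R : Type} [CommRing R] [IsNoetherianRing R] [IsLocalRing R] (xs : List R)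
    (hm : Ideal.ofList xs = maximalIdeal R) (hreg : IsWeaklyRegular R xs) (t : ℕ) (ht : 0 < t) :
    Module.length R (R ⧸ Ideal.ofList (xs.map (· ^ t))) = ((t ^ xs.length : ℕ) : ℕ∞) := by
  obtain ⟨n, rfl⟩ := Nat.exists_eq_succ_of_ne_zero ht.ne'
  have h := length_pow n xs hreg
  have e (I : Ideal R) : Module.length R (R ⧸ (I • ⊤ : Submodule R R)) =
      Module.length R (R ⧸ I) := (Submodule.quotEquivOfEq _ _ (by simp)).length_eq
  rw [e, e, hm, length_max, mul_one] at h
  exact h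

lemma exists_notMem_sup_pow {R : Type} [CommRing R] [IsNoetherianRing R] [IsLocalRing R]
    (I : Ideal R) (x : R) (hx : x ∉ I) : ∃ n, x ∉ I ⊔ maximalIdeal R ^ n := by
  by_contra! h
  apply hx
  have h1 := Ideal.iInf_pow_smul_eq_bot_of_isLocalRing (M := R ⧸ I) (maximalIdeal R)
    (Ideal.IsPrime.ne_top')
  have h2 : (Submodule.Quotient.mk x : R ⧸ I) ∈
      (⨅ i : ℕ, maximalIdeal R ^ i • ⊤ : Submodule R (R ⧸ I)) := by
    rw [Submodule.mem_iInf]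
    intro i
    obtain ⟨a, ha, b, hb, rfl⟩ := Submodule.mem_sup.mp (h i)
    have : (Submodule.Quotient.mk (a + b) : R ⧸ I) = b • Submodule.Quotient.mk 1 := by
      rw [← Submodule.Quotient.mk_smul, Submodule.Quotient.eq]
      simpa using ha
    rw [this]
    exact Submodule.smul_mem_smul hb trivial
  rw [h1] at h2
  exact (Submodule.Quotient.mk_eq_zero I).mp h2

lemma tightClosure_main (R : Type) [CommRing R] [IsNoetherianRing R] [IsLocalRing R]
    (p : ℕ) [Fact p.Prime] [CharP R p] (xs : List R)
    (hm : Ideal.ofList xs = maximalIdeal R) (hreg : IsWeaklyRegular R xs)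
    (I : Ideal R) (x : R) (c : R) (hc0 : c ≠ 0) (e₀ : ℕ)
    (hc : ∀ e ≥ e₀, c * x ^ p ^ e ∈ frobeniusPower I (p ^ e)) : x ∈ I := by
  by_contra hx
  obtain ⟨n, hn⟩ := exists_notMem_sup_pow I x hx
  set I' := I ⊔ maximalIdeal R ^ n with hI'
  obtain ⟨z, hzK, -, hz⟩ := exists_socle (I := I') (K := I' ⊔ Ideal.span {x})
    (fun h => hn (h (Ideal.mem_sup_right (Ideal.mem_span_singleton_self x)))) le_sup_right
  set J := Ideal.ofList (xs.map (· ^ (n + 1))) with hJ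
  have hJI : J ≤ I' := by
    rw [hJ, Ideal.span_le]
    intro a ha
    obtain ⟨b, hb, rfl⟩ := List.mem_map.mp ha
    refine Ideal.mem_sup_right (Ideal.pow_le_pow_right (Nat.le_succ n) (Ideal.pow_mem_pow ?_ _))
    rw [← hm]; exact Ideal.subset_span hb
  obtain ⟨N, hN⟩ : ∃ N, maximalIdeal R ^ N ≤ J := by
    have hrad : maximalIdeal R ≤ J.radical := by
      rw [← hm, Ideal.span_le]
      intro a ha
      exact ⟨n + 1, Ideal.subset_span (List.mem_map.mpr ⟨a, ha, rfl⟩)⟩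
    exact Ideal.exists_pow_le_of_le_radical_of_fg hrad (IsNoetherian.noetherian _)
  have hp : p.Prime := Fact.out
  have hlen (t : ℕ) (ht : 0 < t) := length_ofList_pow xs hm hreg t ht
  apply hc0
  have hmem : ∀ e ≥ e₀, c ∈ maximalIdeal R ^ (p ^ e) := by
    intro e he
    have hq : 0 < p ^ e := pow_pos hp.pos e
    let φ := iterateFrobenius R p e
    have hφ (a : R) : φ a = a ^ p ^ e := iterateFrobenius_def _ _ _
    have hmφ : (maximalIdeal R).map φ = Ideal.ofList (xs.map (· ^ (p ^ e))) := by
      rw [← hm, Ideal.map_ofList]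
      rfl
    have hJφ : J.map φ = Ideal.ofList (xs.map (· ^ ((n + 1) * p ^ e))) := by
      rw [hJ, Ideal.map_ofList, List.map_map]
      have hcomp : (⇑φ ∘ fun x : R => x ^ (n + 1)) = fun x : R => x ^ ((n + 1) * p ^ e) := by
        funext a
        simp only [Function.comp_apply, hφ, ← pow_mul]
      rw [hcomp]
    have key := colon_key φ N J I' hN hJI
      (by rw [hJφ, hlen _ (by positivity)]; exact ENat.natCast_ne_top _)
      (by rw [hJ, hlen _ (by positivity)]; exact ENat.natCast_ne_top _)
      (by rw [hmφ, hlen _ hq]; exact ENat.natCast_ne_top _)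
      (by
        rw [hJφ, hmφ, hJ, hlen _ (by positivity), hlen _ hq, hlen _ (by positivity)]
        push_cast
        rw [← mul_pow, mul_comm])
      z hz c (by
        have hle : I' ⊔ Ideal.span {x} ≤ (colonElt (I'.map φ) c).comap φ := by
          refine sup_le ?_ ?_
          · intro a ha
            rw [Ideal.mem_comap, mem_colonElt]
            exact Ideal.mul_mem_right _ _ (Ideal.mem_map_of_mem _ ha)
          · rw [Ideal.span_le, Set.singleton_subset_iff, SetLike.mem_coe, Ideal.mem_comap,
              mem_colonElt, mul_comm, hφ]
            exact Ideal.map_mono le_sup_left (hc e he)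
        have := hle hzK
        rwa [Ideal.mem_comap, mem_colonElt, mul_comm] at this)
    have hle : (maximalIdeal R).map φ ≤ maximalIdeal R ^ (p ^ e) := by
      rw [Ideal.map_le_iff_le_comap]
      intro a ha
      rw [Ideal.mem_comap, hφ]
      exact Ideal.pow_mem_pow ha _
    exact hle key
  have h0 := Ideal.iInf_pow_eq_bot_of_isLocalRing (maximalIdeal R) (Ideal.IsPrime.ne_top')
  rw [← Ideal.mem_bot, ← h0, Submodule.mem_iInf]
  intro i
  refine Ideal.pow_le_pow_right ?_ (hmem (max e₀ i) (le_max_left _ _))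
  exact (le_max_right _ _).trans (Nat.lt_pow_self hp.one_lt).le

/-- In a regular Noetherian local ring of characteristic `p`, every ideal is
tightly closed; in particular every parameter ideal is tightly closed,
i.e. `R` is F-rational. -/
theorem regular_implies_tightlyClosed
    (R : Type) [CommRing R] [IsNoetherianRing R] [IsLocalRing R]
    (p : ℕ) (hp : p.Prime) [CharP R p]
    (d : ℕ) (hd : ringKrullDim R = d)
    (hreg : ∃ s : Finset R, Ideal.span (s : Set R) = IsLocalRing.maximalIdeal R ∧ s.card = d) :
    (∀ I : Ideal R, tightClosureSet p I = (I : Set R)) ∧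
    (∀ xs : List R, xs.length = d → (∀ x ∈ xs, x ∈ IsLocalRing.maximalIdeal R) →
      IsFiniteLength R (R ⧸ Ideal.span {a : R | a ∈ xs}) →
      tightClosureSet p (Ideal.span {a : R | a ∈ xs}) =
        ((Ideal.span {a : R | a ∈ xs} : Ideal R) : Set R)) := by
  have : Fact p.Prime := ⟨hp⟩
  have main : ∀ I : Ideal R, tightClosureSet p I = (I : Set R) := by
    obtain ⟨s, hs, hcard⟩ := hreg
    have hm : Ideal.ofList s.toList = maximalIdeal R := by
      have hset : {r | r ∈ s.toList} = (s : Set R) := by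
        ext a
        simp
      rw [← hs]
      exact congrArg Ideal.span hset
    obtain ⟨-, hw⟩ := regular_seq d R hd s.toList (by simpa using hcard) hm
    intro I
    ext x
    constructor
    · rintro ⟨c, hc, e₀, h⟩
      have hc0 : c ≠ 0 := by
        rintro rfl
        obtain ⟨P, hP⟩ : Nonempty (minimalPrimes R) := Ideal.nonempty_minimalPrimes bot_ne_top
        exact hc P hP P.zero_mem
      exact tightClosure_main R p s.toList hm hw I x c hc0 e₀ h
    · intro hx
      refine ⟨1, fun P hP h1 => ?_, 0, fun e _ => ?_⟩
      · exact hP.1.1.ne_top ((Ideal.eq_top_iff_one P).mpr h1)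
      · rw [one_mul]
        exact Ideal.subset_span ⟨x, hx, rfl⟩
  exact ⟨main, fun xs _ _ _ => main _⟩
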